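/- Let A be a unital C*-algebra and a, b ∈ A. Then the numerical range of the generalized derivation δ_{a,b}(x) = ax − xb, as an element of B(A), equals the closure of the union over all unitaries u of V(uau* − b, A). -/

import Mathlib

/-- Algebra numerical range of an element of a complex unital Banach algebra,
defined via states: `V(a) = {f a : f ∈ A*, ‖f‖ = 1 = f 1}`. -/
def numRange (A : Type*) [NormedRing A] [NormedAlgebra ℂ A] (a : A) : Set ℂ :=
  {z | ∃ f : A →L[ℂ] ℂ, ‖f‖ = 1 ∧ f 1 = 1 ∧ f a = z}


lemma numRange_iff {B : Type*} [NormedRing B] [NormedAlgebra ℂ B] [NormOneClass B] (a : B) (z : ℂ) :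
    z ∈ numRange B a ↔ ∃ f : B →L[ℂ] ℂ, ‖f‖ ≤ 1 ∧ f 1 = 1 ∧ f a = z := by
  constructor
  · rintro ⟨f, h1, h2, h3⟩
    exact ⟨f, h1.le, h2, h3⟩
  · rintro ⟨f, h1, h2, h3⟩
    refine ⟨f, le_antisymm h1 ?_, h2, h3⟩
    have := f.le_opNorm 1
    simpa [h2] using this

def stateSet (B : Type*) [NormedRing B] [NormedAlgebra ℂ B] : Set (WeakDual ℂ B) :=
  {f | ‖WeakDual.toStrongDual f‖ ≤ 1 ∧ f 1 = 1}

lemma stateSet_compact (B : Type*) [NormedRing B] [NormedAlgebra ℂ B] :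
    IsCompact (stateSet B) := by
  have h := WeakDual.isCompact_closedBall (𝕜 := ℂ) (E := B) 0 1
  have h2 : IsClosed {f : WeakDual ℂ B | f 1 = 1} :=
    isClosed_eq (WeakDual.eval_continuous 1) continuous_const
  have := h.inter_right h2
  convert this using 1
  ext f
  simp [stateSet]

lemma stateSet_convex (B : Type*) [NormedRing B] [NormedAlgebra ℂ B] :
    Convex ℝ (stateSet B) := by
  intro f hf g hg s t hs ht hst
  refine ⟨?_, ?_⟩
  · have e : WeakDual.toStrongDual (s • f + t • g) =
      s • WeakDual.toStrongDual f + t • WeakDual.toStrongDual g := rfl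
    rw [e]
    refine (norm_add_le _ _).trans ?_
    rw [norm_smul, norm_smul, Real.norm_of_nonneg hs, Real.norm_of_nonneg ht]
    have := hf.1
    have := hg.1
    nlinarith
  · have e : (s • f + t • g) 1 = s • f 1 + t • g 1 := rfl
    rw [e, hf.2, hg.2]
    simp only [Complex.real_smul, mul_one]
    exact_mod_cast hst

lemma numRange_closed {B : Type*} [NormedRing B] [NormedAlgebra ℂ B] [NormOneClass B] (a : B) :
    IsClosed (numRange B a) := by
  have : numRange B a = (fun f : WeakDual ℂ B => f a) '' stateSet B := by
    ext z
    rw [numRange_iff]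
    constructor
    · rintro ⟨f, h1, h2, h3⟩
      exact ⟨StrongDual.toWeakDual f, ⟨h1, h2⟩, h3⟩
    · rintro ⟨f, ⟨h1, h2⟩, h3⟩
      exact ⟨WeakDual.toStrongDual f, h1, h2, h3⟩
  rw [this]
  exact ((stateSet_compact B).image (WeakDual.eval_continuous a)).isClosed

lemma wd_cont (A : Type*) [NormedRing A] [NormedAlgebra ℂ A] : ContinuousSMul ℝ (WeakDual ℂ A) := by
  have : IsScalarTower ℝ ℂ (WeakDual ℂ A) := by
    constructor
    intro r c f
    apply DFunLike.ext
    intro x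
    change (r • c) * f x = r • (c * f x)
    simp [mul_assoc]
  exact IsScalarTower.continuousSMul ℂ

lemma wd_lc (A : Type*) [NormedRing A] [NormedAlgebra ℂ A] :
    LocallyConvexSpace ℝ (WeakDual ℂ A) :=
  inferInstanceAs (LocallyConvexSpace ℝ (WeakBilin (topDualPairing ℂ A)))

lemma state_re_le {A : Type*} [NormedRing A] [NormedAlgebra ℂ A] (c : A) (β : ℝ)
    (hg : ∀ g ∈ (stateSet A).extremePoints ℝ, (g c).re ≤ β)
    (f : A →L[ℂ] ℂ) (hf : ‖f‖ ≤ 1) (h1 : f 1 = 1) : (f c).re ≤ β := by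
  have hcl : IsClosed {g : WeakDual ℂ A | (g c).re ≤ β} :=
    isClosed_le (Complex.continuous_re.comp (WeakDual.eval_continuous c)) continuous_const
  have hcv : Convex ℝ {g : WeakDual ℂ A | (g c).re ≤ β} := by
    intro g hg g' hg' s t hs ht hst
    have e : ((s • g + t • g') c).re = s * (g c).re + t * (g' c).re := by
      have : (s • g + t • g') c = s • g c + t • g' c := rfl
      rw [this]; simp
    simp only [Set.mem_ofPred_eq] at *
    rw [e]
    calc s * (g c).re + t * (g' c).re ≤ s * β + t * β := by gcongr
      _ = β := by rw [← add_mul, hst, one_mul]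
  have hK := @closure_convexHull_extremePoints (WeakDual ℂ A) _ _ _ _ _ (wd_cont A) (wd_lc A) _
    (stateSet_compact A) (stateSet_convex A)
  have hm : StrongDual.toWeakDual f ∈ stateSet A := ⟨hf, h1⟩
  rw [← hK] at hm
  have h3 : convexHull ℝ ((stateSet A).extremePoints ℝ) ⊆ {g : WeakDual ℂ A | (g c).re ≤ β} :=
    convexHull_min (fun g h => hg g h) hcv
  have h4 := closure_minimal h3 hcl
  exact h4 hm

section
variable {A : Type*} [CStarAlgebra A]

lemma state_im (f : A →L[ℂ] ℂ) (hf : ‖f‖ ≤ 1) (h1 : f 1 = 1) (h : A) (hh : IsSelfAdjoint h) :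
    (f h).im = 0 := by
  have key : ∀ t : ℝ, ((f h).im + t) ^ 2 ≤ ‖h‖ ^ 2 + t ^ 2 := by
    intro t
    have e : f (h + ((t : ℂ) * Complex.I) • 1) = f h + t * Complex.I := by
      simp [h1]
    have n1 : ‖f (h + ((t : ℂ) * Complex.I) • 1)‖ ≤ ‖h + ((t : ℂ) * Complex.I) • (1 : A)‖ := by
      refine (f.le_opNorm _).trans ?_
      exact mul_le_of_le_one_left (norm_nonneg _) hf
    have n2 : ‖h + ((t : ℂ) * Complex.I) • (1 : A)‖ ^ 2 ≤ ‖h‖ ^ 2 + t ^ 2 := by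
      rw [sq, ← CStarRing.norm_star_mul_self]
      have : star (h + ((t : ℂ) * Complex.I) • (1 : A)) * (h + ((t : ℂ) * Complex.I) • (1 : A)) =
        h * h + ((t ^ 2 : ℝ) : ℂ) • (1 : A) := by
        simp only [star_add, hh.star_eq, star_smul, star_one, add_mul, mul_add, smul_mul_assoc,
          mul_smul_comm, one_mul, mul_one]
        have : star ((t : ℂ) * Complex.I) = -(t * Complex.I) := by simp
        rw [this]
        have : -((t : ℂ) * Complex.I) * (t * Complex.I) = ((t ^ 2 : ℝ) : ℂ) := by
          push_cast
          linear_combination (-(t : ℂ) ^ 2) * Complex.I_sq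
        rw [smul_add, smul_smul, mul_comm _ (-((t : ℂ) * Complex.I)), this]
        module
      rw [this]
      refine (norm_add_le _ _).trans ?_
      refine add_le_add ((norm_mul_le _ _).trans_eq (sq _).symm) ?_
      rw [norm_smul]
      obtain _ | _ := subsingleton_or_nontrivial A
      · simp [Subsingleton.elim (1 : A) 0]; positivity
      · simp
    have n3 : ((f h).im + t) ^ 2 ≤ ‖f h + t * Complex.I‖ ^ 2 := by
      rw [← Complex.normSq_eq_norm_sq, Complex.normSq_apply]
      simp
      nlinarith [mul_self_nonneg (f h).re]
    rw [e] at n1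
    have := pow_le_pow_left₀ (norm_nonneg _) n1 2
    linarith
  by_contra hne
  have hk := key ((‖h‖ ^ 2) / (f h).im)
  have : (f h).im * (‖h‖ ^ 2 / (f h).im) = ‖h‖ ^ 2 := by field_simp
  have p : 0 < (f h).im ^ 2 := by positivity
  nlinarith [sq_nonneg ‖h‖]

lemma state_star (f : A →L[ℂ] ℂ) (hf : ‖f‖ ≤ 1) (h1 : f 1 = 1) (c : A) :
    f (star c) = star (f c) := by
  have e1 := state_im f hf h1 (c + star c) (by simp [IsSelfAdjoint, add_comm])
  have e2 := state_im f hf h1 (Complex.I • (c - star c)) (by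
    simp only [IsSelfAdjoint, star_smul, star_sub, star_star, Complex.star_def, Complex.conj_I]
    module)
  simp at e1 e2
  apply Complex.ext
  · simp; linarith
  · simp; linarith

variable [PartialOrder A] [StarOrderedRing A]

lemma state_nonneg (f : A →L[ℂ] ℂ) (hf : ‖f‖ ≤ 1) (h1 : f 1 = 1) (h : A) (hh : 0 ≤ h) :
    0 ≤ (f h).re := by
  obtain rfl | hne := eq_or_ne h 0
  · simp
  have hn : 0 < ‖h‖ := norm_pos_iff.2 hne
  have l1 : h ≤ algebraMap ℝ A ‖h‖ := IsSelfAdjoint.le_algebraMap_norm_self (.of_nonneg hh)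
  have n : ‖algebraMap ℝ A ‖h‖ - h‖ ≤ ‖h‖ := by
    have := CStarAlgebra.norm_le_norm_of_nonneg_of_le (a := algebraMap ℝ A ‖h‖ - h)
      (b := algebraMap ℝ A ‖h‖) (sub_nonneg.2 l1) (sub_le_self _ hh)
    refine this.trans ?_
    have : Nontrivial A := ⟨h, 0, hne⟩
    simp
  have e : f (algebraMap ℝ A ‖h‖ - h) = ‖h‖ - f h := by
    rw [map_sub, IsScalarTower.algebraMap_apply ℝ ℂ A, Algebra.algebraMap_eq_smul_one, map_smul, h1]
    simp
  have k : ‖f (algebraMap ℝ A ‖h‖ - h)‖ ≤ ‖h‖ :=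
    ((f.le_opNorm _).trans (mul_le_of_le_one_left (norm_nonneg _) hf)).trans n
  rw [e] at k
  have := (Complex.re_le_norm _).trans k
  simp at this
  linarith

lemma exists_state_norm [Nontrivial A] (h : A) (hh : 0 ≤ h) :
    ∃ f : A →L[ℂ] ℂ, ‖f‖ ≤ 1 ∧ f 1 = 1 ∧ f h = ‖h‖ := by
  by_cases h0 : h = 0
  · obtain ⟨f, h1, h2⟩ := exists_dual_vector ℂ (1 : A) (by simp)
    exact ⟨f, h1.le, by simpa using h2, by simp [h0]⟩
  have hn : 0 < ‖h‖ := norm_pos_iff.2 h0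
  have hmem := CStarAlgebra.norm_mem_spectrum_of_nonneg (a := h) hh
  have hm2 : ‖h‖ + ‖h‖ ∈ spectrum ℝ (algebraMap ℝ A ‖h‖ + h) := by
    rw [← spectrum.singleton_add_eq]
    exact Set.add_mem_add rfl hmem
  have hnorm : ‖h‖ + ‖h‖ ≤ ‖algebraMap ℝ A ‖h‖ + h‖ := by
    have := spectrum.norm_le_norm_of_mem hm2
    rwa [Real.norm_of_nonneg (by positivity)] at this
  have hne : algebraMap ℝ A ‖h‖ + h ≠ 0 := by
    intro h'; rw [h', norm_zero] at hnorm; linarith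
  obtain ⟨f, h1, h2⟩ := exists_dual_vector ℂ _ (norm_ne_zero_iff.2 hne)
  have b1 : ‖f 1‖ ≤ 1 := by simpa [h1] using f.le_opNorm 1
  have b2 : ‖f h‖ ≤ ‖h‖ := by simpa [h1] using f.le_opNorm h
  have e : f (algebraMap ℝ A ‖h‖ + h) = ‖h‖ * f 1 + f h := by
    rw [map_add, IsScalarTower.algebraMap_apply ℝ ℂ A, Algebra.algebraMap_eq_smul_one, map_smul]
    simp
  rw [e] at h2
  have r := congrArg Complex.re h2
  have i := congrArg Complex.im h2
  simp at r i
  have r1 := (Complex.re_le_norm _).trans b1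
  have r2 := (Complex.re_le_norm _).trans b2
  have q1 : (f 1).re = 1 := by nlinarith
  have q2 : (f h).re = ‖h‖ := by nlinarith
  have z1 : (f 1).im = 0 := by
    have := Complex.sq_norm_sub_sq_re (f 1)
    nlinarith [norm_nonneg (f 1), sq_nonneg (f 1).im]
  have z2 : (f h).im = 0 := by
    rw [z1] at i; simpa using i
  refine ⟨f, h1.le, Complex.ext (by simpa using q1) (by simpa using z1),
    Complex.ext (by simpa using q2) (by simpa using z2)⟩

lemma norm_one_add_le [Nontrivial A] (c : A) (β : ℝ)
    (hg : ∀ g ∈ (stateSet A).extremePoints ℝ, (g c).re ≤ β) (t : ℝ) (ht : 0 ≤ t) :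
    ‖1 + (t : ℂ) • c‖ ^ 2 ≤ 1 + 2 * t * β + t ^ 2 * ‖c‖ ^ 2 := by
  obtain ⟨f, hf, h1, h2⟩ := exists_state_norm (star (1 + (t : ℂ) • c) * (1 + (t : ℂ) • c))
    (star_mul_self_nonneg _)
  rw [CStarRing.norm_star_mul_self] at h2
  have e : star (1 + (t : ℂ) • c) * (1 + (t : ℂ) • c) =
      1 + (t : ℂ) • (c + star c) + ((t : ℂ) ^ 2) • (star c * c) := by
    simp only [star_add, star_one, star_smul, add_mul, mul_add, one_mul, mul_one, smul_mul_assoc,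
      mul_smul_comm, Complex.star_def, Complex.conj_ofReal]
    module
  rw [e] at h2
  have r := congrArg Complex.re h2
  simp only [map_add, map_smul, h1, state_star f hf h1] at r
  have b : (f (star c * c)).re ≤ ‖c‖ ^ 2 := by
    refine (Complex.re_le_norm _).trans ?_
    refine ((f.le_opNorm _).trans (mul_le_of_le_one_left (norm_nonneg _) hf)).trans ?_
    rw [CStarRing.norm_star_mul_self, sq]
  have bb := state_re_le c β hg f hf h1
  rw [← Complex.ofReal_pow, Complex.ofReal_re, ← sq] at r
  simp only [smul_eq_mul, Complex.add_re, Complex.re_ofReal_mul, Complex.one_re, Complex.star_def,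
    Complex.conj_re] at r
  have : t * (f c).re ≤ t * β := by gcongr
  have : t ^ 2 * (f (star c * c)).re ≤ t ^ 2 * ‖c‖ ^ 2 := by gcongr
  nlinarith

end

section
variable {A : Type*} [CStarAlgebra A] [PartialOrder A] [StarOrderedRing A]

lemma rd_unit (v : A) (hv : IsUnit v) (hn : ‖v‖ ≤ 1) :
    v ∈ convexHull ℝ (unitary A : Set A) := by
  have hpp : CFC.abs v * CFC.abs v = star v * v := CFC.abs_mul_abs v
  have hps : star (CFC.abs v) = CFC.abs v := (IsSelfAdjoint.of_nonneg (CFC.abs_nonneg v)).star_eq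
  have hu : IsUnit (CFC.abs v) := by
    have : IsUnit (CFC.abs v * CFC.abs v) := hpp ▸ (hv.star.mul hv)
    exact (Commute.isUnit_mul_iff (Commute.refl _)).1 this |>.1
  obtain ⟨p, hp⟩ := hu
  obtain ⟨v', hv'⟩ := hv
  have hpi : star (↑p⁻¹ : A) = ↑p⁻¹ := by
    have h2 : star (p : A) = p := by rw [hp, hps]
    have h1 : star p = p := Units.ext h2
    rw [← Units.coe_star_inv, h1]
  have hw1 : star (v * ↑p⁻¹) * (v * ↑p⁻¹) = 1 := by
    rw [star_mul, hpi, mul_assoc, ← mul_assoc (star v), ← hpp, ← hp]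
    simp
  have hwu : v * ↑p⁻¹ ∈ unitary A := by
    have hI : IsUnit (v * ↑p⁻¹) := by rw [← hv']; exact (v' * p⁻¹).isUnit
    refine Unitary.mem_iff.2 ⟨hw1, ?_⟩
    obtain ⟨w, hw⟩ := hI
    rw [← hw] at hw1 ⊢
    have : star (w : A) = ↑w⁻¹ := by
      rw [← mul_one (star (w : A)), ← Units.mul_inv w, ← mul_assoc, hw1, one_mul]
    rw [this, Units.mul_inv]
  have hpn : ‖CFC.abs v‖ ≤ 1 := by rwa [CFC.norm_abs]
  have hun := IsSelfAdjoint.self_add_I_smul_cfcSqrt_sub_sq_mem_unitary (CFC.abs v)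
    (.of_nonneg (CFC.abs_nonneg v)) hpn
  have hun2 := Unitary.star_mem hun
  have hst : star (CFC.abs v + Complex.I • CFC.sqrt (1 - CFC.abs v ^ 2)) =
      CFC.abs v - Complex.I • CFC.sqrt (1 - CFC.abs v ^ 2) := by
    have : star (CFC.sqrt (1 - CFC.abs v ^ 2)) = CFC.sqrt (1 - CFC.abs v ^ 2) :=
      (IsSelfAdjoint.of_nonneg (CFC.sqrt_nonneg _)).star_eq
    rw [star_add, star_smul, this, hps, Complex.star_def, Complex.conj_I]
    module
  rw [hst] at hun2
  have m1 := subset_convexHull ℝ _ (mul_mem hwu hun)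
  have m2 := subset_convexHull ℝ _ (mul_mem hwu hun2)
  have m3 := (convex_convexHull ℝ (unitary A : Set A)) m1 m2 (a := 1/2) (b := 1/2)
    (by norm_num) (by norm_num) (by norm_num)
  convert m3 using 1
  rw [← smul_add, ← mul_add, add_add_sub_cancel, ← two_smul ℝ (CFC.abs v), mul_smul_comm, smul_smul,
    ← hp, mul_assoc]
  simp

lemma rd_mid (y : A) (hy : ‖y‖ < 1) (u : A) (hu : u ∈ unitary A) :
    (1/2 : ℝ) • (y + u) ∈ convexHull ℝ (unitary A : Set A) := by
  obtain _ | _ := subsingleton_or_nontrivial A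
  · rw [Subsingleton.elim ((1/2 : ℝ) • (y + u)) u]
    exact subset_convexHull ℝ _ hu
  have hu1 : ‖u‖ = 1 := CStarRing.norm_of_mem_unitary hu
  apply rd_unit
  · have h1 : ‖-(star u * y)‖ < 1 := by
      rw [norm_neg]
      refine (norm_mul_le _ _).trans_lt ?_
      rwa [norm_star, hu1, one_mul]
    have h2 := isUnit_one_sub_of_norm_lt_one h1
    have h3 : IsUnit u := ⟨Unitary.toUnits ⟨u, hu⟩, rfl⟩
    have h4 : y + u = u * (1 - -(star u * y)) := by
      rw [sub_neg_eq_add, mul_add, ← mul_assoc, (Unitary.mem_iff.1 hu).2]; simp [add_comm]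
    rw [h4]
    have h5 := h3.mul h2
    have := h5.smul (Units.mk0 (1/2 : ℝ) (by norm_num))
    exact this
  · rw [norm_smul]
    have := norm_add_le y u
    norm_num
    linarith

lemma russo_dye (y : A) (hy : ‖y‖ < 1) : y ∈ closure (convexHull ℝ (unitary A : Set A)) := by
  have step : ∀ x ∈ convexHull ℝ (unitary A : Set A),
      (1/2 : ℝ) • (y + x) ∈ convexHull ℝ (unitary A : Set A) := by
    have hc : Convex ℝ {x : A | (1/2 : ℝ) • (y + x) ∈ convexHull ℝ (unitary A : Set A)} := by
      intro x hx x' hx' s t hs ht hst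
      have := (convex_convexHull ℝ (unitary A : Set A)) hx hx' hs ht hst
      change _ ∈ convexHull ℝ (unitary A : Set A)
      convert this using 1
      have : y = s • y + t • y := by rw [← add_smul, hst, one_smul]
      nth_rewrite 1 [this]
      module
    intro x hx
    exact convexHull_min (fun u hu => rd_mid y hy u hu) hc hx
  have key : ∀ n : ℕ, y + ((1/2 : ℝ) ^ n) • (1 - y) ∈ convexHull ℝ (unitary A : Set A) := by
    intro n
    induction n with
    | zero => simpa using subset_convexHull ℝ _ (one_mem (unitary A))
    | succ n ih =>
      convert step _ ih using 1
      rw [pow_succ]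
      module
  have lim : Filter.Tendsto (fun n : ℕ => y + ((1/2 : ℝ) ^ n) • (1 - y)) Filter.atTop (nhds y) := by
    have := (tendsto_pow_atTop_nhds_zero_of_lt_one (r := (1/2 : ℝ)) (by norm_num) (by norm_num))
    have := (this.smul_const (1 - y)).const_add y
    simpa using this
  exact mem_closure_of_tendsto lim (Filter.Eventually.of_forall key)

lemma norm_le_of_unitary (T : A →L[ℂ] A) (K : ℝ) (hK : 0 ≤ K)
    (h : ∀ u ∈ unitary A, ‖T u‖ ≤ K) : ‖T‖ ≤ K := by
  have hc : Convex ℝ {x : A | ‖T x‖ ≤ K} := by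
    intro x hx y hy s t hs ht hst
    simp only [Set.mem_ofPred_eq] at *
    have e : T (s • x + t • y) = s • T x + t • T y := by
      rw [map_add, ← Complex.coe_smul, ← Complex.coe_smul, map_smul, map_smul]; simp
    rw [e]
    refine (norm_add_le _ _).trans ?_
    rw [norm_smul, norm_smul, Real.norm_of_nonneg hs, Real.norm_of_nonneg ht]
    calc s * ‖T x‖ + t * ‖T y‖ ≤ s * K + t * K := by gcongr
      _ = K := by rw [← add_mul, hst, one_mul]
  have hcl : IsClosed {x : A | ‖T x‖ ≤ K} := isClosed_le (by fun_prop) continuous_const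
  refine T.opNorm_le_of_unit_norm hK ?_
  intro x hx
  have hx2 : x ∈ closure (convexHull ℝ (unitary A : Set A)) := by
    have h1 : x ∈ closure (Metric.ball (0 : A) 1) := by
      rw [closure_ball (0 : A) one_ne_zero]
      simp [hx]
    refine closure_minimal ?_ isClosed_closure h1
    intro z hz
    rw [mem_ball_zero_iff] at hz
    exact russo_dye z hz
  exact closure_minimal (convexHull_min (fun u hu => h u hu) hc) hcl hx2

lemma delta_bound [Nontrivial A] (a b : A) (δ : A →L[ℂ] A) (hδ : ∀ x, δ x = a * x - x * b)
    (ω : ℂ) (β : ℝ)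
    (hg : ∀ u ∈ unitary A, ∀ g ∈ (stateSet A).extremePoints ℝ,
      (ω * g (star u * a * u - b)).re ≤ β)
    (F : (A →L[ℂ] A) →L[ℂ] ℂ) (hF : ‖F‖ ≤ 1) (hF1 : F 1 = 1) :
    (ω * F δ).re ≤ β := by
  set M : ℝ := ‖ω‖ * (‖a‖ + ‖b‖) with hM
  have main : ∀ t : ℝ, 0 < t → 2 * t * (ω * F δ).re ≤ 2 * t * β + t ^ 2 * M ^ 2 := by
    intro t ht
    have hu : ∀ u ∈ unitary A, ‖(1 + ((t : ℂ) * ω) • δ) u‖ ^ 2 ≤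
        1 + 2 * t * β + t ^ 2 * M ^ 2 := by
      intro u hu
      have hu1 : ‖u‖ = 1 := CStarRing.norm_of_mem_unitary hu
      set c : A := ω • (star u * a * u - b) with hc
      have hcn : ‖c‖ ≤ M := by
        rw [hc, norm_smul, hM]
        gcongr
        refine (norm_sub_le _ _).trans ?_
        gcongr
        refine (norm_mul_le _ _).trans ?_
        rw [hu1, mul_one]
        refine (norm_mul_le _ _).trans ?_
        rw [norm_star, hu1, one_mul]
      have e : (1 + ((t : ℂ) * ω) • δ) u = u * (1 + (t : ℂ) • c) := by
        have h2 : u * (star u * a * u) = a * u := by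
          rw [← mul_assoc, ← mul_assoc, (Unitary.mem_iff.1 hu).2, one_mul]
        simp only [add_apply, smul_apply,
          one_apply_eq_self, hδ, hc, mul_add, mul_one, mul_smul_comm, mul_sub, h2,
          smul_smul]
      rw [e]
      have h3 : ‖u * (1 + (t : ℂ) • c)‖ ≤ ‖1 + (t : ℂ) • c‖ := by
        refine (norm_mul_le _ _).trans ?_
        rw [hu1, one_mul]
      have h4 := norm_one_add_le c β (fun g hgg => by
        have := hg u hu g hgg
        rw [hc]
        have e : g (ω • (star u * a * u - b)) = ω * g (star u * a * u - b) := map_smul g _ _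
        rwa [e]) t ht.le
      have h5 := pow_le_pow_left₀ (norm_nonneg _) h3 2
      have h6 : t ^ 2 * ‖c‖ ^ 2 ≤ t ^ 2 * M ^ 2 := by gcongr
      linarith
    have hpos : 0 ≤ 1 + 2 * t * β + t ^ 2 * M ^ 2 := (sq_nonneg _).trans (hu 1 (one_mem _))
    have hT := norm_le_of_unitary (1 + ((t : ℂ) * ω) • δ) (Real.sqrt (1 + 2 * t * β + t ^ 2 * M ^ 2))
      (Real.sqrt_nonneg _) (fun u h => Real.le_sqrt_of_sq_le (hu u h))
    have hFn : ‖F (1 + ((t : ℂ) * ω) • δ)‖ ≤ Real.sqrt (1 + 2 * t * β + t ^ 2 * M ^ 2) :=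
      ((F.le_opNorm _).trans (mul_le_of_le_one_left (norm_nonneg _) hF)).trans hT
    have e : F (1 + ((t : ℂ) * ω) • δ) = 1 + t * (ω * F δ) := by
      rw [map_add, map_smul, hF1, smul_eq_mul, mul_assoc]
    rw [e] at hFn
    have h7 := pow_le_pow_left₀ (norm_nonneg _) hFn 2
    rw [Real.sq_sqrt hpos, ← Complex.normSq_eq_norm_sq, Complex.normSq_apply] at h7
    simp only [Complex.add_re, Complex.one_re, Complex.re_ofReal_mul] at h7
    nlinarith [mul_self_nonneg (1 + (t : ℂ) * (ω * F δ)).im, sq_nonneg (t * (ω * F δ).re)]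
  by_contra hcon
  push Not at hcon
  set d := (ω * F δ).re - β with hd
  have hdp : 0 < d := by linarith
  have h8 := main (d / (M ^ 2 + 1)) (by positivity)
  set t := d / (M ^ 2 + 1) with ht
  have htp : 0 < t := by positivity
  have h9 : t * (M ^ 2 + 1) = d := by rw [ht]; field_simp
  have : 2 * t * d ≤ t * (t * M ^ 2) := by nlinarith
  have : 2 * d ≤ t * M ^ 2 := by
    have := le_of_mul_le_mul_left (a := t) (b := 2 * d) (c := t * M ^ 2) (by linarith) htp
    exact this
  nlinarith

end

section
universe u v
variable {A : Type u} [CStarAlgebra A]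

/-- vector functional -/
noncomputable def vecFun {H : Type v} [NormedAddCommGroup H] [InnerProductSpace ℂ H] [CompleteSpace H]
    (π : A →⋆ₐ[ℂ] (H →L[ℂ] H)) (x : H) : A →L[ℂ] ℂ :=
  LinearMap.mkContinuous
    { toFun := fun a => inner ℂ x (π a x)
      map_add' := fun a b => by simp
      map_smul' := fun c a => by simp } (‖x‖ ^ 2) (by
    intro a
    have h1 : ‖π a‖ ≤ ‖a‖ := NonUnitalStarAlgHom.norm_apply_le π a
    calc ‖inner ℂ x (π a x)‖ ≤ ‖x‖ * ‖π a x‖ := norm_inner_le_norm _ _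
      _ ≤ ‖x‖ * (‖a‖ * ‖x‖) := by
        gcongr
        exact (π a).le_of_opNorm_le h1 x
      _ = ‖x‖ ^ 2 * ‖a‖ := by ring)

lemma vecFun_apply {H : Type v} [NormedAddCommGroup H] [InnerProductSpace ℂ H] [CompleteSpace H]
    (π : A →⋆ₐ[ℂ] (H →L[ℂ] H)) (x : H) (a : A) : vecFun π x a = inner ℂ x (π a x) := rfl

lemma vecFun_norm {H : Type v} [NormedAddCommGroup H] [InnerProductSpace ℂ H] [CompleteSpace H]
    (π : A →⋆ₐ[ℂ] (H →L[ℂ] H)) (x : H) : ‖vecFun π x‖ ≤ ‖x‖ ^ 2 :=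
  LinearMap.mkContinuous_norm_le _ (by positivity) _

lemma irr_sa {H : Type v} [NormedAddCommGroup H] [InnerProductSpace ℂ H] [CompleteSpace H]
    (π : A →⋆ₐ[ℂ] (H →L[ℂ] H)) (ξ : H) (hξ : ‖ξ‖ = 1) (hd : DenseRange (fun a => π a ξ))
    (g : WeakDual ℂ A) (hg : g ∈ (stateSet A).extremePoints ℝ)
    (hgξ : ∀ a, g a = inner ℂ ξ (π a ξ)) (T : H →L[ℂ] H) (hT : IsSelfAdjoint T)
    (hc : ∀ a, Commute T (π a)) : ∃ c : ℂ, T = c • 1 := by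
  set N : ℝ := ‖T‖ + 1 with hN
  have hNp : 0 < N := by positivity
  -- general construction
  have gen : ∀ T : H →L[ℂ] H, IsSelfAdjoint T → ‖T‖ + 1 = N → (∀ a, Commute T (π a)) →
      ∃ v : H, v ≠ 0 ∧ ∀ a, inner ℂ v (π a v) = inner ℂ ξ (π a (((N : ℂ) • (1 : H →L[ℂ] H) + T) ξ)) := by
    intro T hT hTN hc
    set P : H →L[ℂ] H := (N : ℂ) • 1 + T with hP
    have hP0 : 0 ≤ P := by
      have h1 := IsSelfAdjoint.neg_algebraMap_norm_le_self hT
      have h2 : P = (T - -algebraMap ℝ (H →L[ℂ] H) ‖T‖) + algebraMap ℝ (H →L[ℂ] H) 1 := by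
        rw [hP, ← hTN, IsScalarTower.algebraMap_apply ℝ ℂ (H →L[ℂ] H),
          IsScalarTower.algebraMap_apply ℝ ℂ (H →L[ℂ] H)]
        simp only [Complex.coe_algebraMap]
        simp only [Algebra.algebraMap_eq_smul_one]
        push_cast
        module
      rw [h2]
      refine add_nonneg (sub_nonneg.2 h1) ?_
      simp
    have hRR : CFC.sqrt P * CFC.sqrt P = P := CFC.sqrt_mul_sqrt_self P hP0
    have hRs : IsSelfAdjoint (CFC.sqrt P) := .of_nonneg (CFC.sqrt_nonneg P)
    have hRc : ∀ a, Commute (CFC.sqrt P) (π a) := by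
      intro a
      have : Commute P (π a) := by
        rw [hP]
        exact Commute.add_left ((Commute.one_left _).smul_left _) (hc a)
      exact this.cfcₙ_nnreal _
    refine ⟨CFC.sqrt P ξ, ?_, ?_⟩
    · intro h0
      have h1 : P ξ = 0 := by
        rw [← hRR, mul_apply_eq_comp, h0, map_zero]
      have h2 : T ξ = -((N : ℂ) • ξ) := by
        rw [hP] at h1
        simp at h1
        exact eq_neg_of_add_eq_zero_right (by simpa using h1)
      have h3 : ‖T ξ‖ = N := by
        rw [h2, norm_neg, norm_smul, hξ]; simp [abs_of_pos hNp]
      have h4 := T.le_opNorm ξ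
      rw [hξ] at h4
      linarith
    · intro a
      have h1 : π a (CFC.sqrt P ξ) = CFC.sqrt P (π a ξ) := by
        have := congrArg (fun S : H →L[ℂ] H => S ξ) (hRc a).eq
        exact this.symm
      rw [h1, ← ContinuousLinearMap.adjoint_inner_right, ← ContinuousLinearMap.star_eq_adjoint,
        hRs.star_eq, ← mul_apply_eq_comp, hRR]
      have : Commute P (π a) := by
        rw [hP]
        exact Commute.add_left ((Commute.one_left _).smul_left _) (hc a)
      rw [← mul_apply_eq_comp, this.eq, mul_apply_eq_comp]
  obtain ⟨v, hv0, hv⟩ := gen T hT rfl hc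
  obtain ⟨w, hw0, hw⟩ := gen (-T) hT.neg (by rw [norm_neg]) (fun a => (hc a).neg_left)
  have hsum : ∀ a, inner ℂ v (π a v) + inner ℂ w (π a w) = (2 * N : ℝ) * g a := by
    intro a
    rw [hv, hw, ← inner_add_right, ← map_add, ← add_apply, hgξ]
    have : (N : ℂ) • (1 : H →L[ℂ] H) + T + ((N : ℂ) • 1 + -T) = ((2 * N : ℝ) : ℂ) • 1 := by
      push_cast; module
    rw [this]
    simp [inner_smul_right]
  have hvp : 0 < ‖v‖ := norm_pos_iff.2 hv0
  have hwp : 0 < ‖w‖ := norm_pos_iff.2 hw0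
  have hst : ∀ v : H, 0 < ‖v‖ → StrongDual.toWeakDual ((((‖v‖ ^ 2)⁻¹ : ℝ) : ℂ) • vecFun π v) ∈ stateSet A := by
    intro v hvp
    constructor
    · change ‖((((‖v‖ ^ 2)⁻¹ : ℝ) : ℂ) • vecFun π v)‖ ≤ 1
      rw [norm_smul]
      have := vecFun_norm π v
      simp only [Complex.norm_real, norm_inv, norm_pow, norm_norm]
      rw [inv_mul_le_one₀ (by positivity)]
      exact this
    · change (((‖v‖ ^ 2)⁻¹ : ℝ) : ℂ) * inner ℂ v (π 1 v) = 1
      rw [map_one, one_apply_eq_self, inner_self_eq_norm_sq_to_K]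
      push_cast
      have : (‖v‖ : ℂ) ≠ 0 := by exact_mod_cast hvp.ne'
      field_simp
      simp
  have hN2 : ‖v‖ ^ 2 + ‖w‖ ^ 2 = 2 * N := by
    have h1 := hsum 1
    have h2 : g 1 = 1 := hg.1.2
    rw [map_one, h2, one_apply_eq_self, one_apply_eq_self,
      inner_self_eq_norm_sq_to_K, inner_self_eq_norm_sq_to_K] at h1
    simp only [Complex.coe_algebraMap, mul_one] at h1
    exact_mod_cast h1
  have hseg : g ∈ openSegment ℝ (StrongDual.toWeakDual ((((‖v‖ ^ 2)⁻¹ : ℝ) : ℂ) • vecFun π v))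
      (StrongDual.toWeakDual ((((‖w‖ ^ 2)⁻¹ : ℝ) : ℂ) • vecFun π w)) := by
    refine ⟨‖v‖ ^ 2 / (2 * N), ‖w‖ ^ 2 / (2 * N), by positivity, by positivity, ?_, ?_⟩
    · rw [← add_div, hN2]; field_simp
    · apply DFunLike.ext
      intro a
      change (‖v‖ ^ 2 / (2 * N)) • ((((‖v‖ ^ 2)⁻¹ : ℝ) : ℂ) * inner ℂ v (π a v)) +
        (‖w‖ ^ 2 / (2 * N)) • ((((‖w‖ ^ 2)⁻¹ : ℝ) : ℂ) * inner ℂ w (π a w)) = g a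
      have h1 := hsum a
      simp only [Complex.real_smul, ← mul_assoc, ← Complex.ofReal_mul]
      have e1 : ‖v‖ ^ 2 / (2 * N) * (‖v‖ ^ 2)⁻¹ = (2 * N)⁻¹ := by field_simp
      have e2 : ‖w‖ ^ 2 / (2 * N) * (‖w‖ ^ 2)⁻¹ = (2 * N)⁻¹ := by field_simp
      rw [e1, e2, ← mul_add, h1, ← mul_assoc, ← Complex.ofReal_mul]
      have : (2 * N)⁻¹ * (2 * N) = 1 := by field_simp
      rw [this]; simp
  have hext := hg.2 (hst v hvp) (hst w hwp) hseg
  have hva : ∀ a, inner ℂ v (π a v) = ((‖v‖ ^ 2 : ℝ) : ℂ) * inner ℂ ξ (π a ξ) := by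
    intro a
    have h1 : (((‖v‖ ^ 2)⁻¹ : ℝ) : ℂ) * inner ℂ v (π a v) = g a := by
      rw [← hext]; rfl
    rw [← hgξ, ← h1, ← mul_assoc, ← Complex.ofReal_mul]
    have : ‖v‖ ^ 2 * (‖v‖ ^ 2)⁻¹ = 1 := by field_simp
    rw [this]; simp
  set c : ℂ := ((‖v‖ ^ 2 : ℝ) : ℂ) - N with hcdef
  have hTξ : T ξ = c • ξ := by
    rw [← sub_eq_zero]
    have horth : ∀ a, inner ℂ (π a ξ) (T ξ - c • ξ) = 0 := by
      intro a
      have h1 := hv (star a)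
      rw [hva (star a)] at h1
      rw [map_star, ContinuousLinearMap.star_eq_adjoint, ContinuousLinearMap.adjoint_inner_right,
        ContinuousLinearMap.adjoint_inner_right] at h1
      simp only [add_apply, smul_apply,
        one_apply_eq_self, inner_add_right, inner_smul_right] at h1
      rw [inner_sub_right, inner_smul_right, hcdef]
      linear_combination -h1
    have hall : ∀ y, inner ℂ y (T ξ - c • ξ) = 0 := by
      intro y
      refine hd.induction_on y ?_ horth
      exact isClosed_eq (by fun_prop) continuous_const
    exact inner_self_eq_zero.1 (hall _)
  refine ⟨c, ?_⟩
  ext y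
  refine hd.induction_on y (isClosed_eq (by fun_prop) (by fun_prop)) ?_
  intro a
  have h1 : T (π a ξ) = π a (T ξ) := congrArg (fun S : H →L[ℂ] H => S ξ) (hc a).eq
  rw [h1, hTξ]
  simp

lemma irr_all {H : Type v} [NormedAddCommGroup H] [InnerProductSpace ℂ H] [CompleteSpace H]
    (π : A →⋆ₐ[ℂ] (H →L[ℂ] H)) (ξ : H) (hξ : ‖ξ‖ = 1) (hd : DenseRange (fun a => π a ξ))
    (g : WeakDual ℂ A) (hg : g ∈ (stateSet A).extremePoints ℝ)
    (hgξ : ∀ a, g a = inner ℂ ξ (π a ξ)) (T : H →L[ℂ] H)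
    (hc : ∀ a, Commute T (π a)) : ∃ c : ℂ, T = c • 1 := by
  have hc' : ∀ a, Commute (star T) (π a) := by
    intro a
    have := (hc (star a)).star_star
    rw [map_star, star_star] at this
    exact this
  obtain ⟨c1, h1⟩ := irr_sa π ξ hξ hd g hg hgξ (T + star T) (by simp [IsSelfAdjoint, add_comm])
    (fun a => (hc a).add_left (hc' a))
  obtain ⟨c2, h2⟩ := irr_sa π ξ hξ hd g hg hgξ (Complex.I • (T - star T)) (by
      simp only [IsSelfAdjoint, star_smul, star_sub, star_star, Complex.star_def, Complex.conj_I]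
      module)
    (fun a => ((hc a).sub_left (hc' a)).smul_left _)
  refine ⟨(c1 - Complex.I * c2) / 2, ?_⟩
  have h3 : T - star T = (-Complex.I * c2) • 1 := by
    rw [← smul_smul, ← h2, smul_smul]; simp
  have : T = (1/2 : ℂ) • ((T + star T) + (T - star T)) := by module
  rw [this, h1, h3]
  module

/-- irreducible representations -/
structure Irrep (A : Type u) [CStarAlgebra A] : Type (u + 1) where
  H : Type u
  [i1 : NormedAddCommGroup H]
  [i2 : InnerProductSpace ℂ H]
  [i3 : CompleteSpace H]
  π : A →⋆ₐ[ℂ] (H →L[ℂ] H)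
  irr : ∀ T : H →L[ℂ] H, (∀ a, Commute T (π a)) → ∃ c : ℂ, T = c • 1

attribute [instance] Irrep.i1 Irrep.i2 Irrep.i3

open scoped ComplexOrder in
lemma exists_irrep [PartialOrder A] [StarOrderedRing A] (g : WeakDual ℂ A)
    (hg : g ∈ (stateSet A).extremePoints ℝ) :
    ∃ (ρ : Irrep A) (ξ : ρ.H), ‖ξ‖ = 1 ∧ ∀ a, g a = inner ℂ ξ (ρ.π a ξ) := by
  have hpos : ∀ x : A, 0 ≤ x → 0 ≤ g x := by
    intro x hx
    have h1 := state_nonneg (WeakDual.toStrongDual g) hg.1.1 hg.1.2 x hx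
    have h2 := state_im (WeakDual.toStrongDual g) hg.1.1 hg.1.2 x (.of_nonneg hx)
    exact Complex.nonneg_iff.2 ⟨h1, h2.symm⟩
  let f : A →ₚ[ℂ] ℂ := PositiveLinearMap.mk₀ (WeakDual.toStrongDual g).toLinearMap hpos
  have hfg : ∀ a, f a = g a := fun a => rfl
  let ξ : f.GNS := ((f.toPreGNS 1 : f.PreGNS) : f.GNS)
  have hπ : ∀ a, f.gnsStarAlgHom a ξ = ((f.toPreGNS a : f.PreGNS) : f.GNS) := by
    intro a
    change f.gnsNonUnitalStarAlgHom a ((f.toPreGNS 1 : f.PreGNS) : f.GNS) = _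
    rw [PositiveLinearMap.gnsNonUnitalStarAlgHom_apply_coe]
    simp
  have hin : ∀ a, g a = inner ℂ ξ (f.gnsStarAlgHom a ξ) := by
    intro a
    rw [hπ, UniformSpace.Completion.inner_coe, PositiveLinearMap.preGNS_inner_def]
    simp [hfg]
  have hξ : ‖ξ‖ = 1 := by
    have h1 := hin 1
    have h2 : g 1 = 1 := hg.1.2
    rw [h2, map_one, one_apply_eq_self, inner_self_eq_norm_sq_to_K] at h1
    simp only [Complex.coe_algebraMap] at h1
    have h3 : ‖ξ‖ ^ 2 = 1 := by exact_mod_cast h1.symm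
    nlinarith [norm_nonneg ξ]
  have hd : DenseRange (fun a => f.gnsStarAlgHom a ξ) := by
    have h1 : (fun a => f.gnsStarAlgHom a ξ) = ((↑) : f.PreGNS → f.GNS) ∘ f.toPreGNS := by
      funext a; exact hπ a
    rw [h1]
    exact UniformSpace.Completion.denseRange_coe.comp f.toPreGNS.surjective.denseRange
      (UniformSpace.Completion.continuous_coe _)
  exact ⟨{ H := f.GNS, π := f.gnsStarAlgHom,
           irr := fun T hT => irr_all f.gnsStarAlgHom ξ hξ hd g hg hin T hT }, ξ, hξ, hin⟩
end
section
/-- numerical range -/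
def wRange {H : Type*} [NormedAddCommGroup H] [InnerProductSpace ℂ H] (T : H →L[ℂ] H) : Set ℂ :=
  {z | ∃ x : H, ‖x‖ = 1 ∧ inner ℂ x (T x) = z}

lemma wRange_affine {H : Type*} [NormedAddCommGroup H] [InnerProductSpace ℂ H] (T : H →L[ℂ] H)
    (c d : ℂ) (x : H) (hx : ‖x‖ = 1) :
    inner ℂ x ((c • (T - d • 1)) x) = c * (inner ℂ x (T x) - d) := by
  have : inner ℂ x x = (1 : ℂ) := by rw [inner_self_eq_norm_sq_to_K, hx]; simp
  simp [hx]

lemma exists_phase (p q : ℂ) : ∃ c : ℂ, ‖c‖ = 1 ∧ (starRingEnd ℂ c * p + c * q).im = 0 := by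
  -- Im(conj c p + c q) = Im (c (q - conj p))
  by_cases h : q - starRingEnd ℂ p = 0
  · refine ⟨1, by simp, ?_⟩
    have : q = starRingEnd ℂ p := by linear_combination h
    simp [this]
  · refine ⟨starRingEnd ℂ (q - starRingEnd ℂ p) / ‖q - starRingEnd ℂ p‖, ?_, ?_⟩
    · rw [norm_div, RCLike.norm_conj]; simp [h]
    · set r := q - starRingEnd ℂ p with hr
      set c := starRingEnd ℂ r / (‖r‖ : ℂ) with hc
      have h1 : (starRingEnd ℂ c * p + c * q).im = (c * r).im := by
        simp [hr, mul_sub, Complex.mul_im]; ring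
      rw [h1, hc, div_mul_eq_mul_div, mul_comm, Complex.mul_conj, ← Complex.ofReal_div]
      simp

lemma th_aux {H : Type*} [NormedAddCommGroup H] [InnerProductSpace ℂ H] (T : H →L[ℂ] H)
    (x y : H) (hx : ‖x‖ = 1) (hy : ‖y‖ = 1) (hx0 : inner ℂ x (T x) = 0) (hy1 : inner ℂ y (T y) = 1)
    (t : ℝ) (ht : t ∈ Set.Icc (0:ℝ) 1) : (t : ℂ) ∈ wRange T := by
  obtain ⟨c, hc, hc'⟩ := exists_phase (inner ℂ x (T y)) (inner ℂ y (T x))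
  set x' := c • x with hx'
  have hcc : starRingEnd ℂ c * c = 1 := by
    rw [mul_comm, Complex.mul_conj, Complex.normSq_eq_norm_sq, hc]; simp
  have hx'0 : inner ℂ x' (T x') = 0 := by
    simp [hx', hx0]
  have him : (inner ℂ x' (T y) + inner ℂ y (T x')).im = 0 := by
    rw [← hc', hx', map_smul, inner_smul_left, inner_smul_right]
  have hx'1 : ‖x'‖ = 1 := by simp [hx', norm_smul, hc, hx]
  let v : ℝ → H := fun s => ((1 - s : ℝ) : ℂ) • x' + ((s : ℝ) : ℂ) • y
  have hv : ∀ s, v s ≠ 0 := by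
    intro s hs
    have h1 : ((1 - s : ℝ) : ℂ) • x' = -((s : ℝ) : ℂ) • y := by
      rw [neg_smul]; exact eq_neg_of_add_eq_zero_left hs
    have h2 : inner ℂ (((1 - s : ℝ) : ℂ) • x') (T (((1 - s : ℝ) : ℂ) • x')) = 
       inner ℂ (-((s : ℝ) : ℂ) • y) (T (-((s : ℝ) : ℂ) • y)) := by rw [h1]
    simp only [map_smul, inner_smul_left, inner_smul_right, hx'0, hy1] at h2
    have h3 : s = 0 := by
      simp at h2; exact h2
    have h4 := congrArg norm h1
    simp [h3, hx'1] at h4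
  let r := (inner ℂ x' (T y) + inner ℂ y (T x')).re
  have hr : inner ℂ x' (T y) + inner ℂ y (T x') = (r : ℂ) := Complex.ext (by simp [r]) (by simpa using him)
  have hq : ∀ s, inner ℂ (v s) (T (v s)) = ((s ^ 2 + s * (1 - s) * r : ℝ) : ℂ) := by
    intro s
    simp only [v, map_add, map_smul, inner_add_left, inner_add_right, inner_smul_left,
      inner_smul_right, hx'0, hy1, Complex.conj_ofReal]
    push_cast
    rw [← hr]; ring
  let φ : ℝ → ℝ := fun s => (s ^ 2 + s * (1 - s) * r) / ‖v s‖ ^ 2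
  have hvc : Continuous v := by fun_prop
  have hφ : Continuous φ := by
    apply Continuous.div (by fun_prop) (by fun_prop)
    intro s; have := norm_pos_iff.2 (hv s); positivity
  have h0 : φ 0 = 0 := by simp [φ]
  have h1 : φ 1 = 1 := by simp [φ, v, hy]
  have := intermediate_value_Icc (zero_le_one) hφ.continuousOn
  rw [h0, h1] at this
  obtain ⟨s, -, hs⟩ := this ht
  have hp := norm_pos_iff.2 (hv s)
  have hpc : (‖v s‖ : ℂ) ≠ 0 := by exact_mod_cast hp.ne'
  refine ⟨((‖v s‖⁻¹ : ℝ) : ℂ) • v s, ?_, ?_⟩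
  · rw [norm_smul]; simp; field_simp
  · simp only [map_smul, inner_smul_left, inner_smul_right, hq, Complex.conj_ofReal, ← Complex.ofReal_mul]
    rw [← hs]
    congr 1
    simp only [φ]; field_simp

lemma toeplitz_hausdorff {H : Type*} [NormedAddCommGroup H] [InnerProductSpace ℂ H] (T : H →L[ℂ] H) :
    Convex ℝ (wRange T) := by
  rw [convex_iff_segment_subset]
  rintro α ⟨x, hx, hxα⟩ β ⟨y, hy, hyβ⟩
  rw [segment_eq_image_lineMap]
  rintro _ ⟨t, ht, rfl⟩
  by_cases h : α = β
  · subst h; simpa using ⟨x, hx, hxα⟩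
  have h' : β - α ≠ 0 := sub_ne_zero.2 (Ne.symm h)
  obtain ⟨w, hw, hw'⟩ := th_aux ((β - α)⁻¹ • (T - α • 1)) x y hx hy
    (by rw [wRange_affine _ _ _ _ hx, hxα]; simp)
    (by rw [wRange_affine _ _ _ _ hy, hyβ]; field_simp) t ht
  rw [wRange_affine _ _ _ _ hw] at hw'
  refine ⟨w, hw, ?_⟩
  rw [AffineMap.lineMap_apply]
  simp only [vsub_eq_sub, vadd_eq_add, Complex.real_smul]
  rw [← hw']; field_simp; ring
end
section
universe u w
variable {A : Type u} [CStarAlgebra A]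

noncomputable def dgOp {κ : Type*} [Fintype κ] {H : κ → Type w} [∀ k, NormedAddCommGroup (H k)]
    [∀ k, InnerProductSpace ℂ (H k)] (S : ∀ k, H k →L[ℂ] H k) : PiLp 2 H →L[ℂ] PiLp 2 H :=
  ((PiLp.continuousLinearEquiv 2 ℂ H).symm : _ →L[ℂ] _) ∘L
    (ContinuousLinearMap.pi fun k => (S k) ∘L (PiLp.proj 2 H k : PiLp 2 H →L[ℂ] H k))

lemma dgOp_apply {κ : Type*} [Fintype κ] {H : κ → Type w} [∀ k, NormedAddCommGroup (H k)]
    [∀ k, InnerProductSpace ℂ (H k)] (S : ∀ k, H k →L[ℂ] H k) (v : PiLp 2 H) (k : κ) :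
    dgOp S v k = S k (v k) := rfl

noncomputable def inOp {κ : Type*} [Fintype κ] [DecidableEq κ] (H : κ → Type w) [∀ k, NormedAddCommGroup (H k)]
    [∀ k, InnerProductSpace ℂ (H k)] (l : κ) : H l →L[ℂ] PiLp 2 H :=
  ((PiLp.continuousLinearEquiv 2 ℂ H).symm : _ →L[ℂ] _) ∘L
    (ContinuousLinearMap.single ℂ H l)

lemma dgOp_inOp {κ : Type*} [Fintype κ] [DecidableEq κ] {H : κ → Type w} [∀ k, NormedAddCommGroup (H k)]
    [∀ k, InnerProductSpace ℂ (H k)] (S : ∀ k, H k →L[ℂ] H k) (l : κ) (z : H l) :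
    dgOp S (inOp H l z) = inOp H l (S l z) := by
  ext k
  rw [dgOp_apply]
  change S k (Pi.single l z k) = Pi.single l (S l z) k
  by_cases h : k = l
  · subst h; simp
  · simp [h]

lemma sum_inOp {κ : Type*} [Fintype κ] [DecidableEq κ] {H : κ → Type w} [∀ k, NormedAddCommGroup (H k)]
    [∀ k, InnerProductSpace ℂ (H k)] (v : PiLp 2 H) : ∑ l, inOp H l (v l) = v := by
  have : ∀ l, inOp H l (v l) = WithLp.toLp 2 (Pi.single l (v l)) := fun l => rfl
  simp only [this]
  rw [← WithLp.toLp_sum, Finset.univ_sum_single]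

lemma dblcomm {κ : Type*} [Fintype κ] {H : κ → Type w} [∀ k, NormedAddCommGroup (H k)]
    [∀ k, InnerProductSpace ℂ (H k)] [∀ k, CompleteSpace (H k)]
    (π : ∀ k, A →⋆ₐ[ℂ] (H k →L[ℂ] H k)) (T : ∀ k, H k →L[ℂ] H k)
    (hT : ∀ k l (W : H l →L[ℂ] H k), (∀ h z, W (π l h z) = π k h (W z)) → ∀ z, W (T l z) = T k (W z))
    (x p : ∀ k, H k) (h0 : ∀ h, ∑ k, inner ℂ (p k) (π k h (x k)) = 0) :
    ∑ k, inner ℂ (p k) (T k (x k)) = 0 := by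
  classical
  let D : A → (PiLp 2 H →L[ℂ] PiLp 2 H) := fun h => dgOp (fun k => π k h)
  have hDm : ∀ h h' v, D (h * h') v = D h (D h' v) := by
    intro h h' v; ext k; simp [D, dgOp_apply]
  have hDadj : ∀ h v w, inner ℂ (D h v) w = inner ℂ v (D (star h) w) := by
    intro h v w
    simp only [PiLp.inner_apply]
    refine Finset.sum_congr rfl fun k _ => ?_
    simp only [D, dgOp_apply, map_star, ContinuousLinearMap.star_eq_adjoint]
    rw [ContinuousLinearMap.adjoint_inner_right]
  let X : PiLp 2 H := WithLp.toLp 2 x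
  let L : A →ₗ[ℂ] PiLp 2 H :=
    { toFun := fun h => D h X
      map_add' := fun a b => by ext k; simp [D, dgOp_apply]
      map_smul' := fun c a => by ext k; simp [D, dgOp_apply] }
  let M := L.range.topologicalClosure
  have hMc : IsClosed (M : Set (PiLp 2 H)) := Submodule.isClosed_topologicalClosure _
  have : CompleteSpace M := hMc.completeSpace_coe
  have hDM : ∀ h, ∀ v ∈ M, D h v ∈ M := by
    intro h v hv
    have : Set.MapsTo (D h) (L.range : Set (PiLp 2 H)) (L.range : Set (PiLp 2 H)) := by
      rintro _ ⟨h', rfl⟩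
      exact ⟨h * h', hDm _ _ _⟩
    exact this.closure (D h).continuous hv
  have hDMo : ∀ h, ∀ v ∈ Mᗮ, D h v ∈ Mᗮ := by
    intro h v hv
    rw [Submodule.mem_orthogonal'] at hv ⊢
    intro m hm
    rw [hDadj]
    exact hv _ (hDM _ _ hm)
  let P := M.starProjection
  have hPD : ∀ h v, P (D h v) = D h (P v) := by
    intro h v
    apply Submodule.eq_starProjection_of_mem_orthogonal
    · exact hDM _ _ (Submodule.starProjection_apply_mem _ _)
    · rw [← map_sub]
      exact hDMo _ _ (Submodule.sub_starProjection_mem_orthogonal _)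
  have hW : ∀ k l z, (P (inOp H l (T l z))) k = T k ((P (inOp H l z)) k) := by
    intro k l z
    refine hT k l ((PiLp.proj 2 H k : PiLp 2 H →L[ℂ] H k) ∘L P ∘L inOp H l) ?_ z
    intro h z
    change (P (inOp H l (π l h z))) k = π k h ((P (inOp H l z)) k)
    rw [← dgOp_inOp (fun l => π l h) l z]
    change (P (D h _)) k = _
    rw [hPD]
    rfl
  have hPT : P (dgOp T X) = dgOp T (P X) := by
    ext k
    rw [dgOp_apply, ← sum_inOp (dgOp T X)]
    conv_rhs => rw [← sum_inOp X]
    simp only [map_sum, WithLp.ofLp_sum, Finset.sum_apply, dgOp_apply, hW]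
  have hX : X ∈ M := by
    apply Submodule.le_topologicalClosure
    refine ⟨1, ?_⟩
    ext k; simp [L, D, dgOp_apply]
  have hPX : P X = X := Submodule.starProjection_eq_self_iff.2 hX
  have hTX : dgOp T X ∈ M := by
    rw [hPX] at hPT
    rw [← hPT]
    exact Submodule.starProjection_apply_mem _ _
  have hp : ∀ v ∈ M, inner ℂ (WithLp.toLp 2 p : PiLp 2 H) v = 0 := by
    intro v hv
    refine closure_minimal (s := (L.range : Set (PiLp 2 H))) (t := {v | inner ℂ (WithLp.toLp 2 p : PiLp 2 H) v = 0}) ?_ ?_ hv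
    · rintro _ ⟨h, rfl⟩
      change inner ℂ (WithLp.toLp 2 p : PiLp 2 H) (D h X) = 0
      rw [PiLp.inner_apply]
      exact h0 h
    · exact isClosed_eq (by fun_prop) continuous_const
  have := hp _ hTX
  rw [PiLp.inner_apply] at this
  exact this
end
section
universe u w
variable {A : Type u} [CStarAlgebra A]

open ComplexStarModule in
lemma kad_orth {J : Type*} [Fintype J] (ρ : J → Irrep A)
    (hne : ∀ j l, j ≠ l → ∀ W : (ρ l).H →L[ℂ] (ρ j).H,
      (∀ h z, W ((ρ l).π h z) = (ρ j).π h (W z)) → W = 0)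
    (x y : ∀ j, (ρ j).H) (S : ∀ j, (ρ j).H →L[ℂ] (ρ j).H)
    (hS : ∀ j z w, inner ℂ (S j z) w = inner ℂ z (S j w))
    (hx : ∀ j, S j (x j) = y j) (hy : ∀ j, S j (y j) = x j)
    (p q : ∀ j, (ρ j).H)
    (h0 : ∀ h : A, IsSelfAdjoint h →
      (∑ j, (inner ℂ (p j) ((ρ j).π h (x j)) + inner ℂ (q j) ((ρ j).π h (y j)))).re = 0) :
    (∑ j, (inner ℂ (p j) (y j) + inner ℂ (q j) (x j))).re = 0 := by
  have hadj : ∀ h : A, IsSelfAdjoint h → ∀ j (z w : (ρ j).H),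
      inner ℂ ((ρ j).π h z) w = inner ℂ z ((ρ j).π h w) := by
    intro h hh j z w
    have h1 : IsSelfAdjoint ((ρ j).π h) := hh.map (ρ j).π
    exact h1.isSymmetric z w
  let φ : A →ₗ[ℂ] ℂ :=
    { toFun := fun h => ∑ j, (inner ℂ (p j) ((ρ j).π h (x j)) + inner ℂ (q j) ((ρ j).π h (y j)) +
        inner ℂ (x j) ((ρ j).π h (p j)) + inner ℂ (y j) ((ρ j).π h (q j)))
      map_add' := fun a b => by
        rw [← Finset.sum_add_distrib]
        refine Finset.sum_congr rfl fun j _ => ?_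
        simp only [map_add, add_apply, inner_add_right]; ring
      map_smul' := fun c a => by
        simp only [RingHom.id_apply, smul_eq_mul]
        rw [Finset.mul_sum]
        refine Finset.sum_congr rfl fun j _ => ?_
        simp only [map_smul, smul_apply, inner_smul_right]; ring }
  have hre : ∀ F G : ∀ j, ℂ, (∑ j : J, (F j + G j)).re = 0 → 
      ∑ j, (F j + G j + starRingEnd ℂ (F j) + starRingEnd ℂ (G j)) = 0 := by
    intro F G h
    have : ∑ j, (F j + G j + starRingEnd ℂ (F j) + starRingEnd ℂ (G j)) =
       (∑ j, (F j + G j)) + starRingEnd ℂ (∑ j, (F j + G j)) := by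
      rw [map_sum, ← Finset.sum_add_distrib]
      refine Finset.sum_congr rfl fun j _ => ?_
      rw [map_add]; ring
    rw [this, Complex.add_conj, h]; simp
  have hφsa : ∀ h, IsSelfAdjoint h → φ h = 0 := by
    intro h hh
    have h2 := hre _ _ (h0 h hh)
    rw [← h2]
    refine Finset.sum_congr rfl fun j _ => ?_
    rw [inner_conj_symm, inner_conj_symm, hadj h hh, hadj h hh]
  have hφ : ∀ h, φ h = 0 := by
    intro h
    rw [← realPart_add_I_smul_imaginaryPart h, map_add, map_smul, hφsa _ (realPart h).2,
      hφsa _ (imaginaryPart h).2]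
    simp
  have key := dblcomm (A := A) (κ := J × Fin 4) (H := fun k => (ρ k.1).H) (fun k => (ρ k.1).π)
    (fun k => S k.1) (by
      rintro ⟨j, i⟩ ⟨l, i'⟩ W hW z
      dsimp only at W hW z ⊢
      by_cases hjl : j = l
      · subst hjl
        obtain ⟨c, rfl⟩ := (ρ j).irr W (fun a => by ext z; exact hW a z)
        simp
      · rw [hne j l hjl W hW]; simp)
    (fun k => ![x k.1, y k.1, p k.1, q k.1] k.2) (fun k => ![p k.1, q k.1, x k.1, y k.1] k.2) (by
      intro h
      rw [Fintype.sum_prod_type]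
      simp only [Fin.sum_univ_four]
      exact hφ h)
  rw [Fintype.sum_prod_type] at key
  simp only [Fin.sum_univ_four] at key
  change ∑ j, (inner ℂ (p j) (S j (x j)) + inner ℂ (q j) (S j (y j)) +
    inner ℂ (x j) (S j (p j)) + inner ℂ (y j) (S j (q j))) = 0 at key
  have e : ∑ j, (inner ℂ (p j) (S j (x j)) + inner ℂ (q j) (S j (y j)) +
    inner ℂ (x j) (S j (p j)) + inner ℂ (y j) (S j (q j))) =
       (∑ j, (inner ℂ (p j) (y j) + inner ℂ (q j) (x j))) +
        starRingEnd ℂ (∑ j, (inner ℂ (p j) (y j) + inner ℂ (q j) (x j))) := by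
    rw [map_sum, ← Finset.sum_add_distrib]
    refine Finset.sum_congr rfl fun j _ => ?_
    rw [map_add, inner_conj_symm, inner_conj_symm, hx, hy, ← hS j (x j), ← hS j (y j), hx, hy]; ring
  rw [e, Complex.add_conj] at key
  have := congrArg Complex.re key
  simpa using this

lemma kad {J : Type*} [Fintype J] (ρ : J → Irrep A)
    (hne : ∀ j l, j ≠ l → ∀ W : (ρ l).H →L[ℂ] (ρ j).H,
      (∀ h z, W ((ρ l).π h z) = (ρ j).π h (W z)) → W = 0)
    (x y : ∀ j, (ρ j).H) (S : ∀ j, (ρ j).H →L[ℂ] (ρ j).H)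
    (hS : ∀ j z w, inner ℂ (S j z) w = inner ℂ z (S j w))
    (hx : ∀ j, S j (x j) = y j) (hy : ∀ j, S j (y j) = x j) (η : ℝ) (hη : 0 < η) :
    ∃ h : A, IsSelfAdjoint h ∧ ∀ j, ‖(ρ j).π h (x j) - y j‖ ≤ η ∧ ‖(ρ j).π h (y j) - x j‖ ≤ η := by
  let HH : J × Fin 2 → Type u := fun k => (ρ k.1).H
  let E := PiLp 2 HH
  let L : selfAdjoint A →ₗ[ℝ] PiLp 2 HH :=
    { toFun := fun h => WithLp.toLp 2 fun k => (ρ k.1).π (h : A) (![x k.1, y k.1] k.2)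
      map_add' := fun a b => by ext k; simp [HH]
      map_smul' := fun c a => by
        ext k
        simp only [selfAdjoint.val_smul]
        have : c • (a : A) = (c : ℂ) • (a : A) := (Complex.coe_smul c (a : A)).symm
        rw [this, map_smul]
        rfl }
  let v : PiLp 2 HH := WithLp.toLp 2 fun k => ![y k.1, x k.1] k.2
  have hv : v ∈ closure (L.range : Set (PiLp 2 HH)) := by
    by_contra hv
    obtain ⟨f, c, hf1, hf2⟩ := RCLike.geometric_hahn_banach_closed_point (𝕜 := ℂ)
      (L.range.convex.closure) isClosed_closure hv
    have hc : 0 < c := by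
      have := hf1 0 (subset_closure (Submodule.zero_mem _)); simpa using this
    have hz : ∀ h, (f (L h)).re = 0 := by
      intro h
      by_contra hne
      have := hf1 (L ((c / (f (L h)).re) • h)) (subset_closure ⟨_, rfl⟩)
      rw [map_smul] at this
      have e : f ((c / (f (L h)).re) • L h) = ((c / (f (L h)).re : ℝ) : ℂ) * f (L h) := by
        rw [← Complex.coe_smul, map_smul]; rfl
      rw [e] at this
      simp at this
      field_simp at this
      simp at this
    let P : PiLp 2 HH := (InnerProductSpace.toDual ℂ (PiLp 2 HH)).symm f
    have hP : ∀ w : PiLp 2 HH, f w = ∑ j, (inner ℂ (P (j,0)) (w (j,0)) + inner ℂ (P (j,1)) (w (j,1))) := by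
      intro w
      rw [← InnerProductSpace.toDual_symm_apply, PiLp.inner_apply, Fintype.sum_prod_type]
      simp only [Fin.sum_univ_two]
      rfl
    have := kad_orth ρ hne x y S hS hx hy (fun j => P (j,0)) (fun j => P (j,1)) (by
      intro h hh
      have := hz ⟨h, hh⟩
      rw [hP] at this
      exact this)
    have h2 : (f v).re = 0 := by rw [hP]; exact this
    change c < (f v).re at hf2
    linarith
  obtain ⟨_, ⟨h, rfl⟩, hh⟩ := Metric.mem_closure_iff.1 hv η hη
  refine ⟨h, h.2, fun j => ?_⟩
  have hk : ∀ k, ‖(L h - v) k‖ ≤ η := by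
    intro k
    refine (PiLp.norm_apply_le _ k).trans ?_
    rw [← dist_eq_norm, dist_comm]; exact hh.le
  exact ⟨hk (j, 0), hk (j, 1)⟩
end
section
universe u w
variable {A : Type u} [CStarAlgebra A]

lemma exists_refl {H : Type*} [NormedAddCommGroup H] [InnerProductSpace ℂ H] (x y : H)
    (hx : ‖x‖ = 1) (hy : ‖y‖ = 1) (hxy : inner ℂ x y = (inner ℂ y x : ℂ)) :
    ∃ S : H →L[ℂ] H, (∀ z w, inner ℂ (S z) w = (inner ℂ z (S w) : ℂ)) ∧ S x = y ∧ S y = x := by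
  let e := x - y
  let c : ℂ := 2 * (inner ℂ e e)⁻¹
  have hx1 : inner ℂ x x = (1 : ℂ) := by rw [inner_self_eq_norm_sq_to_K, hx]; simp
  have hy1 : inner ℂ y y = (1 : ℂ) := by rw [inner_self_eq_norm_sq_to_K, hy]; simp
  have hee : inner ℂ e e = (2 - 2 * inner ℂ y x : ℂ) := by
    simp only [e, inner_sub_left, inner_sub_right, hx1, hy1, hxy]; ring
  have hSz : ∀ z, (1 - c • (innerSL ℂ e).smulRight e : H →L[ℂ] H) z = z - (c * inner ℂ e z) • e := by
    intro z; simp [smul_smul]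
  have hcc : starRingEnd ℂ c = c := by
    simp only [c, map_mul, map_inv₀, inner_conj_symm]; rw [map_ofNat]
  have h1 : ∀ z, inner ℂ e z = (2⁻¹ * inner ℂ e e : ℂ) → (c * inner ℂ e z) • e = e := by
    intro z hz
    by_cases h : e = 0
    · simp [h]
    · have : (inner ℂ e e : ℂ) ≠ 0 := inner_self_ne_zero.2 h
      rw [hz]; simp only [c]; field_simp; simp
  refine ⟨1 - c • (innerSL ℂ e).smulRight e, ?_, ?_, ?_⟩
  · intro z w
    rw [hSz, hSz, inner_sub_left, inner_sub_right, inner_smul_left, inner_smul_right, map_mul, hcc,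
      inner_conj_symm]
    ring
  · rw [hSz, h1]
    · simp [e]
    · rw [hee]; simp only [e, inner_sub_left, hx1]; ring
  · rw [hSz]
    have h2 := h1 (-y) (by
      rw [hee]; simp only [e, inner_sub_left, inner_neg_right, hy1, hxy]; ring)
    rw [inner_neg_right, mul_neg, neg_smul] at h2
    rw [sub_eq_add_neg, h2]; simp [e]

lemma cayley (h : A) (hh : IsSelfAdjoint h) : ∃ u ∈ unitary A,
    (h + algebraMap ℂ A Complex.I) * u = h - algebraMap ℂ A Complex.I := by
  have hu : IsUnit (h + algebraMap ℂ A Complex.I) := by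
    by_contra hc
    have h1 : -Complex.I ∈ spectrum ℂ h := by
      rw [spectrum.mem_iff]
      intro h2
      apply hc
      have := h2.neg
      simpa [add_comm] using this
    have := hh.mem_spectrum_eq_re h1
    have := congrArg Complex.im this
    simp at this
  obtain ⟨v, hv⟩ := hu
  have hsv : ((star v : Aˣ) : A) = h - algebraMap ℂ A Complex.I := by
    rw [Units.coe_star, hv, star_add, hh.star_eq, ← algebraMap_star_comm]
    simp [sub_eq_add_neg]
  have hcomm : v * star v = star v * v := by
    ext
    rw [Units.val_mul, Units.val_mul, hsv, hv]
    have := Algebra.commutes Complex.I h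
    simp only [mul_sub, add_mul, mul_add, sub_mul, this]
    abel
  let U : Aˣ := star v * v⁻¹
  have hs : star U = (star v)⁻¹ * v := by
    simp [U]
  have e1 : star U * U = 1 := by
    rw [hs]; simp only [U]
    rw [mul_assoc, ← mul_assoc v, hcomm]; group
  have e2 : U * star U = 1 := mul_eq_one_comm.1 e1
  refine ⟨(U : A), ?_, ?_⟩
  · rw [Unitary.mem_iff, ← Units.coe_star, ← Units.val_mul, ← Units.val_mul, e1, e2]
    simp
  · rw [← hsv, ← hv, ← Units.val_mul]
    congr 1
    simp only [U]
    rw [← mul_assoc, hcomm]; group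

lemma kad_unitary {J : Type*} [Fintype J] (ρ : J → Irrep A)
    (hne : ∀ j l, j ≠ l → ∀ W : (ρ l).H →L[ℂ] (ρ j).H,
      (∀ h z, W ((ρ l).π h z) = (ρ j).π h (W z)) → W = 0)
    (x y : ∀ j, (ρ j).H) (hx : ∀ j, ‖x j‖ = 1) (hy : ∀ j, ‖y j‖ = 1)
    (hxy : ∀ j, inner ℂ (x j) (y j) = (inner ℂ (y j) (x j) : ℂ))
    (η : ℝ) (hη : 0 < η) :
    ∃ u ∈ unitary A, ∀ j, ‖(ρ j).π u (x j) + Complex.I • y j‖ ≤ 2 * η := by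
  choose S hS1 hS2 hS3 using fun j => exists_refl (x j) (y j) (hx j) (hy j) (hxy j)
  obtain ⟨h, hh, hb⟩ := kad ρ hne x y S hS1 hS2 hS3 η hη
  obtain ⟨u, hu, hu'⟩ := cayley h hh
  refine ⟨u, hu, fun j => ?_⟩
  obtain ⟨b1, b2⟩ := hb j
  set w := (ρ j).π u (x j) + Complex.I • y j with hw
  have hH : ∀ z, (ρ j).π (h + algebraMap ℂ A Complex.I) z = (ρ j).π h z + Complex.I • z := by
    intro z
    rw [map_add, add_apply, AlgHomClass.commutes]
    rfl
  have hH' : ∀ z, (ρ j).π (h - algebraMap ℂ A Complex.I) z = (ρ j).π h z - Complex.I • z := by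
    intro z
    rw [map_sub, sub_apply, AlgHomClass.commutes]
    rfl
  have e1 : (ρ j).π (h + algebraMap ℂ A Complex.I) w =
      ((ρ j).π h (x j) - y j) + Complex.I • ((ρ j).π h (y j) - x j) := by
    rw [hw, map_add, ← mul_apply_eq_comp, ← map_mul, hu', hH', map_smul, hH, smul_add, smul_smul]
    simp only [Complex.I_mul_I]
    module
  have e2 : ‖(ρ j).π (h + algebraMap ℂ A Complex.I) w‖ ≤ 2 * η := by
    rw [e1]
    refine (norm_add_le _ _).trans ?_
    rw [norm_smul]; simp only [Complex.norm_I, one_mul]; linarith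
  have e3 : ‖w‖ ^ 2 ≤ ‖w‖ * ‖(ρ j).π (h + algebraMap ℂ A Complex.I) w‖ := by
    have h1 : IsSelfAdjoint ((ρ j).π h) := hh.map (ρ j).π
    have h2 : (inner ℂ w ((ρ j).π h w)).im = 0 := by
      have h3 : starRingEnd ℂ (inner ℂ w ((ρ j).π h w)) = inner ℂ w ((ρ j).π h w) := by
        rw [inner_conj_symm]; exact h1.isSymmetric w w
      exact Complex.conj_eq_iff_im.1 h3
    have h4 : (inner ℂ w ((ρ j).π (h + algebraMap ℂ A Complex.I) w)).im = ‖w‖ ^ 2 := by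
      rw [hH, inner_add_right, inner_smul_right, inner_self_eq_norm_sq_to_K, Complex.add_im, h2]
      simp [← Complex.ofReal_pow]
    rw [← h4]
    exact ((le_abs_self _).trans (Complex.abs_im_le_norm _)).trans (norm_inner_le_norm _ _)
  by_cases h0 : ‖w‖ = 0
  · rw [h0]; positivity
  · have : 0 < ‖w‖ := lt_of_le_of_ne (norm_nonneg _) (Ne.symm h0)
    have : ‖w‖ ≤ ‖(ρ j).π (h + algebraMap ℂ A Complex.I) w‖ := by
      rw [sq] at e3; exact le_of_mul_le_mul_left e3 this
    linarith
end
section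
universe u w
variable {A : Type u} [CStarAlgebra A]
open scoped Pointwise

def Irrep.Equiv (ρ σ : Irrep A) : Prop :=
  ∃ V : ρ.H ≃ₗᵢ[ℂ] σ.H, ∀ h z, V (ρ.π h z) = σ.π h (V z)

def irrepSetoid (A : Type u) [CStarAlgebra A] : Setoid (Irrep A) where
  r := Irrep.Equiv
  iseqv :=
    { refl := fun ρ => ⟨LinearIsometryEquiv.refl ℂ _, fun _ _ => rfl⟩
      symm := by
        rintro ρ σ ⟨V, hV⟩
        refine ⟨V.symm, fun h z => ?_⟩
        apply V.injective
        rw [hV]; simp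
      trans := by
        rintro ρ σ τ ⟨V, hV⟩ ⟨W, hW⟩
        exact ⟨V.trans W, fun h z => by simp [hV, hW]⟩ }

lemma intw_equiv (ρ σ : Irrep A) (W : ρ.H →L[ℂ] σ.H) (hW : ∀ h z, W (ρ.π h z) = σ.π h (W z))
    (h0 : W ≠ 0) : ρ.Equiv σ := by
  have hadj : ∀ h z, W.adjoint (σ.π h z) = ρ.π h (W.adjoint z) := by
    intro h z
    apply ext_inner_left ℂ
    intro y
    rw [ContinuousLinearMap.adjoint_inner_right]
    have e1 : ∀ (τ : Irrep A) (s t : τ.H), inner ℂ s (τ.π h t) = inner ℂ (τ.π (star h) s) t := by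
      intro τ s t
      rw [map_star, ContinuousLinearMap.star_eq_adjoint, ContinuousLinearMap.adjoint_inner_left]
    rw [e1, e1, ContinuousLinearMap.adjoint_inner_right, hW]
  obtain ⟨c, hc⟩ := ρ.irr (W.adjoint ∘L W) (fun a => by
    ext z; simp [hW, hadj])
  obtain ⟨d, hd⟩ := σ.irr (W ∘L W.adjoint) (fun a => by
    ext z; simp [hW, hadj])
  have hc' : ∀ z, W.adjoint (W z) = c • z := fun z => congrArg (fun T : ρ.H →L[ℂ] ρ.H => T z) hc
  have hd' : ∀ z, W (W.adjoint z) = d • z := fun z => congrArg (fun T : σ.H →L[ℂ] σ.H => T z) hd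
  obtain ⟨z0, hz0⟩ : ∃ z, W z ≠ 0 := by
    by_contra hn
    push Not at hn
    exact h0 (by ext z; simpa using hn z)
  have hz0' : z0 ≠ 0 := by rintro rfl; simp at hz0
  have hn : ∀ z, ((‖W z‖ ^ 2 : ℝ) : ℂ) = c * ((‖z‖ ^ 2 : ℝ) : ℂ) := by
    intro z
    have h1 : inner ℂ z (W.adjoint (W z)) = c * inner ℂ z z := by rw [hc', inner_smul_right]
    rw [ContinuousLinearMap.adjoint_inner_right, inner_self_eq_norm_sq_to_K,
      inner_self_eq_norm_sq_to_K] at h1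
    simpa using h1
  have hp0 : 0 < ‖z0‖ := norm_pos_iff.2 hz0'
  have hp1 : 0 < ‖W z0‖ := norm_pos_iff.2 hz0
  let r : ℝ := ‖W z0‖ / ‖z0‖
  have hr : 0 < r := by positivity
  have hcr : c = ((r ^ 2 : ℝ) : ℂ) := by
    have h1 := hn z0
    have : ((‖z0‖ ^ 2 : ℝ) : ℂ) ≠ 0 := by exact_mod_cast (by positivity)
    have h2 : c = ((‖W z0‖ ^ 2 : ℝ) : ℂ) / ((‖z0‖ ^ 2 : ℝ) : ℂ) := by rw [h1]; field_simp
    rw [h2, ← Complex.ofReal_div]; simp only [r, div_pow]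
  have hc0 : c ≠ 0 := by rw [hcr]; exact_mod_cast (by positivity)
  have hnr : ∀ z, ‖W z‖ = r * ‖z‖ := by
    intro z
    have h1 := hn z
    rw [hcr, ← Complex.ofReal_mul] at h1
    have h2 : ‖W z‖ ^ 2 = (r * ‖z‖) ^ 2 := by
      rw [mul_pow]; exact_mod_cast h1
    exact (pow_left_inj₀ (norm_nonneg _) (by positivity) two_ne_zero).1 h2
  have hdc : d = c := by
    have h1 := hd' (W z0)
    rw [hc', map_smul] at h1
    exact (smul_left_injective ℂ hz0 h1).symm
  have hrc : (r : ℂ) ≠ 0 := by exact_mod_cast hr.ne'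
  let V0 : ρ.H →ₗᵢ[ℂ] σ.H :=
    { toLinearMap := (((r : ℂ)⁻¹ • W : ρ.H →L[ℂ] σ.H) : ρ.H →ₗ[ℂ] σ.H)
      norm_map' := by
        intro z
        change ‖(r : ℂ)⁻¹ • W z‖ = ‖z‖
        rw [norm_smul, hnr, norm_inv, Complex.norm_real, Real.norm_of_nonneg hr.le]
        field_simp }
  have hV0 : ∀ z, V0 z = (r : ℂ)⁻¹ • W z := fun z => rfl
  have hsurj : Function.Surjective V0 := by
    intro y
    refine ⟨((r : ℂ) * c⁻¹) • W.adjoint y, ?_⟩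
    rw [hV0, map_smul, hd', hdc, smul_smul, smul_smul]
    have : (r : ℂ)⁻¹ * (r * c⁻¹) * c = 1 := by field_simp
    rw [this, one_smul]
  refine ⟨LinearIsometryEquiv.ofSurjective V0 hsurj, fun h z => ?_⟩
  change V0 _ = σ.π h (V0 z)
  rw [hV0, hV0, hW, map_smul]

lemma wRange_equiv (ρ σ : Irrep A) (h : ρ.Equiv σ) (a : A) : wRange (ρ.π a) ⊆ wRange (σ.π a) := by
  obtain ⟨V, hV⟩ := h
  rintro _ ⟨x, hx, rfl⟩
  refine ⟨V x, by simp [hx], ?_⟩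
  rw [← hV, LinearIsometryEquiv.inner_map_map]

def eSet (ρ : Irrep A) (a b : A) : Set ℂ := wRange (ρ.π a) - wRange (ρ.π b)

lemma eSet_convex (ρ : Irrep A) (a b : A) : Convex ℝ (eSet ρ a b) :=
  (toeplitz_hausdorff _).sub (toeplitz_hausdorff _)

lemma eSet_equiv (ρ σ : Irrep A) (h : ρ.Equiv σ) (a b : A) : eSet ρ a b ⊆ eSet σ a b :=
  Set.sub_subset_sub (wRange_equiv _ _ h _) (wRange_equiv _ _ h _)

lemma conv_one {ι : Type*} (C : Set ℂ) (hC : Convex ℝ C) (F : Finset ι) (hF : F.Nonempty) (w : ι → ℝ)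
    (z : ι → ℂ) (hw : ∀ i ∈ F, 0 ≤ w i) (hz : ∀ i ∈ F, z i ∈ C) :
    ∃ ζ ∈ C, (∑ i ∈ F, w i) • ζ = ∑ i ∈ F, w i • z i := by
  by_cases h : ∑ i ∈ F, w i = 0
  · obtain ⟨i0, hi0⟩ := hF
    refine ⟨z i0, hz _ hi0, ?_⟩
    rw [h, zero_smul]
    symm
    apply Finset.sum_eq_zero
    intro i hi
    rw [(Finset.sum_eq_zero_iff_of_nonneg hw).1 h i hi, zero_smul]
  · refine ⟨F.centerMass w z, hC.centerMass_mem hw (lt_of_le_of_ne (Finset.sum_nonneg hw) (Ne.symm h)) hz, ?_⟩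
    rw [Finset.centerMass, smul_smul, mul_inv_cancel₀ h, one_smul]

lemma hull_repr (a b : A) (z : ℂ) (hz : z ∈ convexHull ℝ (⋃ ρ : Irrep A, eSet ρ a b)) :
    ∃ (J : Type (u+1)) (_ : Fintype J) (ρ : J → Irrep A) (t : J → ℝ) (ζ : J → ℂ),
      (∀ j l, j ≠ l → ∀ W : (ρ l).H →L[ℂ] (ρ j).H,
        (∀ h z, W ((ρ l).π h z) = (ρ j).π h (W z)) → W = 0) ∧
      (∀ j, 0 ≤ t j) ∧ ∑ j, t j = 1 ∧ (∀ j, ζ j ∈ eSet (ρ j) a b) ∧ ∑ j, t j • ζ j = z := by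
  classical
  rw [mem_convexHull_iff_exists_fintype] at hz
  obtain ⟨ι, _, w, f, hw, hw1, hf, hsum⟩ := hz
  simp only [Set.mem_iUnion] at hf
  choose τ hτ using hf
  let q : ι → Quotient (irrepSetoid A) := fun i => Quotient.mk _ (τ i)
  let s : Finset (Quotient (irrepSetoid A)) := Finset.univ.image q
  have key : ∀ j : s, ∃ ζ ∈ eSet (Quotient.out j.1) a b,
      (∑ i with q i = j.1, w i) • ζ = ∑ i with q i = j.1, w i • f i := by
    rintro ⟨j, hj⟩
    apply conv_one _ (eSet_convex _ _ _)
    · obtain ⟨i, -, hi⟩ := Finset.mem_image.1 hj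
      exact ⟨i, by simp [hi]⟩
    · intro i _; exact hw i
    · intro i hi
      have hi' : q i = j := by simpa using hi
      refine eSet_equiv _ _ ?_ _ _ (hτ i)
      have : (irrepSetoid A).r (τ i) (Quotient.out j) := by
        apply Quotient.exact (s := irrepSetoid A)
        rw [Quotient.out_eq]; exact hi'
      exact this
  choose ζ hζ1 hζ2 using key
  have hmaps : ∀ i ∈ (Finset.univ : Finset ι), q i ∈ s := fun i hi => Finset.mem_image_of_mem _ hi
  refine ⟨s, inferInstance, fun j => Quotient.out j.1, fun j => ∑ i with q i = j.1, w i, ζ, ?_, ?_, ?_, hζ1, ?_⟩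
  · intro j l hjl W hW
    by_contra h0
    have h1 : (irrepSetoid A).r (Quotient.out l.1) (Quotient.out j.1) := intw_equiv _ _ W hW h0
    have h2 := Quotient.sound (s := irrepSetoid A) h1
    rw [Quotient.out_eq, Quotient.out_eq] at h2
    exact hjl (Subtype.ext h2.symm)
  · intro j; exact Finset.sum_nonneg fun i _ => hw i
  · rw [← hw1, ← Finset.sum_fiberwise_of_maps_to hmaps]
    exact Finset.sum_coe_sort s (fun j => ∑ i with q i = j, w i)
  · simp only [hζ2]
    rw [← hsum, ← Finset.sum_fiberwise_of_maps_to hmaps]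
    exact Finset.sum_coe_sort s (fun j => ∑ i with q i = j, w i • f i)
end
section
universe u w
variable {A : Type u} [CStarAlgebra A]
open scoped Pointwise

lemma hull_sub [Nontrivial A] (a b : A) (z : ℂ) (hz : z ∈ convexHull ℝ (⋃ ρ : Irrep A, eSet ρ a b)) :
    z ∈ closure (⋃ u : unitary A, numRange A ((u : A) * a * star (u : A) - b)) := by
  obtain ⟨J, _, ρ, t, ζ, hne, ht0, ht1, hζ, hsum⟩ := hull_repr a b z hz
  have hxy : ∀ j, ∃ x y : (ρ j).H, ‖x‖ = 1 ∧ ‖y‖ = 1 ∧ inner ℂ x y = (inner ℂ y x : ℂ) ∧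
      ζ j = inner ℂ y ((ρ j).π a y) - inner ℂ x ((ρ j).π b x) := by
    intro j
    obtain ⟨_, ⟨y, hy, rfl⟩, _, ⟨x, hx, rfl⟩, h⟩ := Set.mem_sub.1 (hζ j)
    obtain ⟨c, hc, hc'⟩ := exists_phase 0 (inner ℂ x y)
    refine ⟨x, c • y, hx, by rw [norm_smul, hc, hy, one_mul], ?_, ?_⟩
    · rw [mul_zero, zero_add] at hc'
      have h1 : inner ℂ x (c • y) = c * inner ℂ x y := inner_smul_right _ _ _
      rw [← inner_conj_symm (c • y) x, h1, Complex.conj_eq_iff_im.2 hc']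
    · have hcc : starRingEnd ℂ c * c = 1 := by
        rw [mul_comm, Complex.mul_conj, Complex.normSq_eq_norm_sq, hc]; simp
      rw [← h, map_smul, inner_smul_left, inner_smul_right, ← mul_assoc, hcc, one_mul]
  choose x y hx hy hxy hζe using hxy
  rw [Metric.mem_closure_iff]
  intro ε hε
  let η : ℝ := ε / (8 * (‖a‖ + 1))
  have hη : 0 < η := by positivity
  obtain ⟨u, hu, hub⟩ := kad_unitary ρ hne x y hx hy hxy η hη
  let f : A →L[ℂ] ℂ := ∑ j, (t j : ℂ) • vecFun (ρ j).π (x j)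
  have hfa : ∀ c, f c = ∑ j, (t j : ℂ) * inner ℂ (x j) ((ρ j).π c (x j)) := by
    intro c
    simp only [f, sum_apply, smul_apply, vecFun_apply, smul_eq_mul]
  have hf1 : f 1 = 1 := by
    rw [hfa]
    simp only [map_one, one_apply_eq_self, inner_self_eq_norm_sq_to_K, hx]
    simp only [map_one, one_pow, mul_one]
    exact_mod_cast ht1
  have hfn : ‖f‖ ≤ 1 := by
    refine (norm_sum_le _ _).trans ?_
    rw [← ht1]
    refine Finset.sum_le_sum fun j _ => ?_
    rw [norm_smul, Complex.norm_real, Real.norm_of_nonneg (ht0 j)]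
    have := vecFun_norm (ρ j).π (x j)
    rw [hx j, one_pow] at this
    nlinarith [ht0 j]
  refine ⟨f (star u * a * u - b), ?_, ?_⟩
  · rw [Set.mem_iUnion]
    refine ⟨star ⟨u, hu⟩, ?_⟩
    rw [numRange_iff]
    refine ⟨f, hfn, hf1, ?_⟩
    simp
  · have hterm : ∀ j, ‖ζ j - inner ℂ (x j) ((ρ j).π (star u * a * u - b) (x j))‖ ≤ 4 * η * ‖a‖ := by
      intro j
      set w := (ρ j).π u (x j) with hw
      set w' := -(Complex.I • y j) with hw'
      have e1 : inner ℂ (x j) ((ρ j).π (star u * a * u - b) (x j)) =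
          inner ℂ w ((ρ j).π a w) - inner ℂ (x j) ((ρ j).π b (x j)) := by
        rw [map_sub, sub_apply, inner_sub_right, map_mul, map_mul, mul_apply_eq_comp, mul_apply_eq_comp,
          map_star, ContinuousLinearMap.star_eq_adjoint, ContinuousLinearMap.adjoint_inner_right]
      have e2 : inner ℂ (y j) ((ρ j).π a (y j)) = inner ℂ w' ((ρ j).π a w') := by
        rw [hw', map_neg, inner_neg_neg, map_smul, inner_smul_left, inner_smul_right, ← mul_assoc]
        simp
      have hd : ‖w' - w‖ ≤ 2 * η := by
        have := hub j
        rw [norm_sub_rev, hw', sub_neg_eq_add]; exact this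
      have hπn : ∀ c : A, ‖(ρ j).π c‖ ≤ ‖c‖ := fun c => NonUnitalStarAlgHom.norm_apply_le (ρ j).π c
      have hwn : ‖w‖ ≤ 1 := by
        have h1 := (ρ j).π u |>.le_opNorm (x j)
        rw [hx j, mul_one] at h1
        exact h1.trans ((hπn u).trans (CStarRing.norm_of_mem_unitary hu).le)
      have hwn' : ‖w'‖ = 1 := by rw [hw', norm_neg, norm_smul, hy j]; simp
      have e3 : ζ j - inner ℂ (x j) ((ρ j).π (star u * a * u - b) (x j)) =
          inner ℂ (w' - w) ((ρ j).π a w') + inner ℂ w ((ρ j).π a (w' - w)) := by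
        rw [e1, hζe j, e2, map_sub, inner_sub_left, inner_sub_right]; ring
      rw [e3]
      have b1 : ‖inner ℂ (w' - w) ((ρ j).π a w')‖ ≤ 2 * η * ‖a‖ := by
        refine (norm_inner_le_norm _ _).trans ?_
        have : ‖(ρ j).π a w'‖ ≤ ‖a‖ := by
          have h1 := (ρ j).π a |>.le_opNorm w'
          rw [hwn', mul_one] at h1
          exact h1.trans (hπn a)
        gcongr
      have b2 : ‖inner ℂ w ((ρ j).π a (w' - w))‖ ≤ 2 * η * ‖a‖ := by
        refine (norm_inner_le_norm _ _).trans ?_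
        have : ‖(ρ j).π a (w' - w)‖ ≤ ‖a‖ * (2 * η) := by
          refine ((ρ j).π a |>.le_opNorm _).trans ?_
          have := hπn a
          gcongr
        calc ‖w‖ * ‖(ρ j).π a (w' - w)‖ ≤ 1 * (‖a‖ * (2 * η)) := by gcongr
          _ = _ := by ring
      refine (norm_add_le _ _).trans ?_
      linarith
    have h4 : ‖z - f (star u * a * u - b)‖ ≤ 4 * η * ‖a‖ := by
      rw [← hsum, hfa, ← Finset.sum_sub_distrib]
      refine (norm_sum_le _ _).trans ?_
      calc _ ≤ ∑ j, t j * (4 * η * ‖a‖) := by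
            refine Finset.sum_le_sum fun j _ => ?_
            rw [Complex.real_smul, ← mul_sub, norm_mul, Complex.norm_real, Real.norm_of_nonneg (ht0 j)]
            exact mul_le_mul_of_nonneg_left (hterm j) (ht0 j)
        _ = _ := by rw [← Finset.sum_mul, ht1, one_mul]
    rw [dist_eq_norm]
    refine h4.trans_lt ?_
    have h5 : 4 * η * ‖a‖ = ε * (‖a‖ / (2 * (‖a‖ + 1))) := by
      simp only [η]; field_simp; ring
    rw [h5]
    have h6 : ‖a‖ / (2 * (‖a‖ + 1)) < 1 := by
      rw [div_lt_one (by positivity)]; linarith [norm_nonneg a]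
    nlinarith

lemma main_aux [PartialOrder A] [StarOrderedRing A] [Nontrivial A]
    (a b : A) (δ : A →L[ℂ] A) (hδ : ∀ x, δ x = a * x - x * b) :
    numRange (A →L[ℂ] A) δ =
      closure (⋃ u : unitary A, numRange A ((u : A) * a * star (u : A) - b)) := by
  apply Set.Subset.antisymm
  · intro z hz
    obtain ⟨F, hF, hF1, hFz⟩ := (numRange_iff δ z).1 hz
    have hcl : closure (convexHull ℝ (⋃ ρ : Irrep A, eSet ρ a b)) ⊆
        closure (⋃ u : unitary A, numRange A ((u : A) * a * star (u : A) - b)) :=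
      closure_minimal (fun z hz => hull_sub a b z hz) isClosed_closure
    apply hcl
    by_contra hn
    obtain ⟨f, c, hf1, hf2⟩ := RCLike.geometric_hahn_banach_closed_point (𝕜 := ℂ)
      (convex_convexHull ℝ (⋃ ρ : Irrep A, eSet ρ a b)).closure isClosed_closure hn
    have hfw : ∀ w, f w = f 1 * w := by
      intro w
      have : f (w • (1 : ℂ)) = w • f 1 := map_smul f w 1
      rw [smul_eq_mul, mul_one, smul_eq_mul] at this
      rw [this, mul_comm]
    have := delta_bound a b δ hδ (f 1) c (by
      intro u hu g hg
      obtain ⟨ρ, ξ, hξ, hgξ⟩ := exists_irrep g hg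
      rw [← hfw]
      refine (hf1 _ (subset_closure (subset_convexHull ℝ _ (Set.mem_iUnion.2 ⟨ρ, ?_⟩)))).le
      refine Set.mem_sub.2 ⟨_, ⟨ρ.π u ξ, ?_, rfl⟩, _, ⟨ξ, hξ, rfl⟩, ?_⟩
      · have h1 : inner ℂ (ρ.π u ξ) (ρ.π u ξ) = (inner ℂ ξ ξ : ℂ) := by
          rw [← ContinuousLinearMap.adjoint_inner_right, ← ContinuousLinearMap.star_eq_adjoint,
            ← map_star, ← mul_apply_eq_comp, ← map_mul, (Unitary.mem_iff.1 hu).1, map_one]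
          rfl
        rw [inner_self_eq_norm_sq_to_K, inner_self_eq_norm_sq_to_K, hξ] at h1
        simp only [Complex.coe_algebraMap] at h1
        have h3 : ‖ρ.π u ξ‖ ^ 2 = 1 ^ 2 := by exact_mod_cast h1
        exact (pow_left_inj₀ (norm_nonneg _) zero_le_one two_ne_zero).1 h3
      · rw [hgξ, map_sub, sub_apply, inner_sub_right, map_mul, map_mul, mul_apply_eq_comp,
          mul_apply_eq_comp, map_star, ContinuousLinearMap.star_eq_adjoint,
          ContinuousLinearMap.adjoint_inner_right]) F hF hF1
    rw [hFz, ← hfw] at this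
    exact absurd hf2 (not_lt.2 this)
  · apply closure_minimal _ (numRange_closed δ)
    intro z hz
    obtain ⟨u, hz⟩ := Set.mem_iUnion.1 hz
    obtain ⟨f, hf, hf1, hfz⟩ := (numRange_iff _ z).1 hz
    rw [numRange_iff]
    have hu := Unitary.mem_iff.1 u.2
    refine ⟨(f ∘L ContinuousLinearMap.mul ℂ A (u : A)) ∘L
      (ContinuousLinearMap.apply ℂ A (star (u : A))), ?_, ?_, ?_⟩
    · refine ContinuousLinearMap.opNorm_le_bound _ zero_le_one fun T => ?_
      change ‖f ((u : A) * T (star (u : A)))‖ ≤ 1 * ‖T‖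
      have h1 : ‖(u : A)‖ = 1 := CStarRing.norm_of_mem_unitary u.2
      calc _ ≤ ‖f‖ * ‖(u : A) * T (star (u : A))‖ := f.le_opNorm _
        _ ≤ 1 * (‖(u : A)‖ * (‖T‖ * ‖star (u : A)‖)) := by
          gcongr
          exact (norm_mul_le _ _).trans (mul_le_mul_of_nonneg_left (T.le_opNorm _) (norm_nonneg _))
        _ = _ := by rw [norm_star, h1]; ring
    · change f ((u : A) * star (u : A)) = 1
      rw [hu.2, hf1]
    · change f ((u : A) * δ (star (u : A))) = z
      rw [hδ, mul_sub, ← mul_assoc, ← mul_assoc, hu.2, one_mul, hfz]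
end

theorem stmt6 (A : Type*) [NormedRing A] [StarRing A] [CStarRing A] [CompleteSpace A]
    [NormedAlgebra ℂ A] [StarModule ℂ A] [NormOneClass A]
    (a b : A) (δ : A →L[ℂ] A) (hδ : ∀ x, δ x = a * x - x * b) :
    numRange (A →L[ℂ] A) δ =
      closure (⋃ u : unitary A, numRange A ((u : A) * a * star (u : A) - b)) := by
  letI : CStarAlgebra A := {}
  letI : PartialOrder A := CStarAlgebra.spectralOrder A
  haveI : StarOrderedRing A := CStarAlgebra.spectralOrderedRing A
  haveI : Nontrivial A := NormOneClass.nontrivial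
  exact main_aux a b δ hδ
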